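/- Fix finite alphabets 𝒳, 𝒲, X̂ and a distortion measure d : 𝒳 × X̂ → [0, d̄] with d_min = min{d(x,x̂) : d(x,x̂) > 0} > 0, such that for every x there exists x̂ with d(x,x̂) = 0. Then for any two joint pmfs P_{XW}, Q_{XW} on 𝒳 × 𝒲 and any D ≥ 0, |R_{X|W}(P_{XW}, D) − R_{X|W}(Q_{XW}, D)| ≤ 10·(d̄/d_min)·‖P_{XW} − Q_{XW}‖₁ · log₂(|𝒳|·|𝒲|·|X̂| / ‖P_{XW} − Q_{XW}‖₁), provided ‖P_{XW} − Q_{XW}‖₁ is sufficiently small (≤ 1/2). -/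

import Mathlib

open Finset

/-- Conditional mutual information `I(X; X̂ | W)` (in bits) of a joint pmf `Q` on `𝒳 × 𝒲`
and a test channel `V : 𝒳 × 𝒲 → X̂`. -/
noncomputable def condMutualInfo {𝒳 𝒲 Xh : Type*} [Fintype 𝒳] [Fintype 𝒲] [Fintype Xh]
    (Q : 𝒳 × 𝒲 → ℝ) (V : 𝒳 × 𝒲 → Xh → ℝ) : ℝ :=
  ∑ x, ∑ w, ∑ xh, Q (x, w) * V (x, w) xh *
    Real.logb 2 (V (x, w) xh /
      (∑ x', (Q (x', w) / ∑ x'', Q (x'', w)) * V (x', w) xh))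

/-- Conditional rate-distortion function `R_{X|W}(Q, D)`. -/
noncomputable def condRD {𝒳 𝒲 Xh : Type*} [Fintype 𝒳] [Fintype 𝒲] [Fintype Xh]
    (Q : 𝒳 × 𝒲 → ℝ) (d : 𝒳 × Xh → ℝ) (D : ℝ) : ℝ :=
  sInf { r : ℝ | ∃ V : 𝒳 × 𝒲 → Xh → ℝ,
    (∀ p xh, 0 ≤ V p xh) ∧ (∀ p, ∑ xh, V p xh = 1) ∧
    (∑ x, ∑ w, ∑ xh, Q (x, w) * V (x, w) xh * d (x, xh)) ≤ D ∧
    r = condMutualInfo Q V }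

/-- Shannon entropy, in nats, of a mass function on a finite type. -/
noncomputable def finEntropy {A : Type*} [Fintype A] (p : A → ℝ) : ℝ :=
  ∑ a, Real.negMulLog (p a)

/-- The second marginal of a mass function on a product. -/
def sndMarginal {A B : Type*} [Fintype A] (p : A × B → ℝ) (b : B) : ℝ :=
  ∑ a, p (a, b)

/-- The joint mass function of source, side information and reconstruction induced by a source
and a test channel. -/
def jointMass {𝒳 𝒲 Xh : Type*} (Q : 𝒳 × 𝒲 → ℝ) (V : 𝒳 × 𝒲 → Xh → ℝ) (a : 𝒳 × 𝒲 × Xh) : ℝ :=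
  Q (a.1, a.2.1) * V (a.1, a.2.1) a.2.2

theorem le_one_of_mem_stdSimplex {A : Type*} [Fintype A] {p : A → ℝ} (hp : p ∈ stdSimplex ℝ A)
    (a : A) : p a ≤ 1 :=
  hp.2 ▸ single_le_sum (fun i _ => hp.1 i) (mem_univ a)

theorem negMulLog_add_le {a r : ℝ} (ha : 0 ≤ a) (hr : 0 ≤ r) :
    Real.negMulLog (a + r) ≤ Real.negMulLog a + Real.negMulLog r := by
  rcases ha.eq_or_lt with rfl | ha
  · simp
  rcases hr.eq_or_lt with rfl | hr
  · simp
  have h1 : Real.log a ≤ Real.log (a + r) := Real.log_le_log ha (by linarith)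
  have h2 : Real.log r ≤ Real.log (a + r) := Real.log_le_log hr (by linarith)
  simp only [Real.negMulLog]
  nlinarith

theorem negMulLog_le_negMulLog_add {a r : ℝ} (ha : 0 ≤ a) (hr : 0 ≤ r) (har : a + r ≤ 1) :
    Real.negMulLog a ≤ Real.negMulLog (a + r) + r := by
  rcases ha.eq_or_lt with rfl | ha
  · have := Real.negMulLog_nonneg hr (by linarith)
    simp
    linarith
  have h1 : Real.log (a + r) ≤ 0 := Real.log_nonpos (by linarith) har
  have h2 : Real.log ((a + r) / a) ≤ (a + r) / a - 1 :=
    Real.log_le_sub_one_of_pos (by positivity)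
  rw [Real.log_div (by positivity) ha.ne'] at h2
  have h3 : a * (Real.log (a + r) - Real.log a) ≤ r := by
    calc _ ≤ a * ((a + r) / a - 1) := by gcongr
      _ = r := by field_simp; ring
  simp only [Real.negMulLog]
  nlinarith

theorem negMulLog_sub_le {a b : ℝ} (ha : 0 ≤ a) (hb : 0 ≤ b) (hb1 : b ≤ 1) :
    Real.negMulLog a - Real.negMulLog b ≤ Real.negMulLog |a - b| + |a - b| := by
  rcases le_total a b with h | h
  · rw [abs_of_nonpos (by linarith)]
    have h1 := negMulLog_le_negMulLog_add (r := b - a) ha (by linarith) (by linarith)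
    have h2 := Real.negMulLog_nonneg (x := -(a - b)) (by linarith) (by linarith)
    rw [add_sub_cancel] at h1
    linarith
  · rw [abs_of_nonneg (by linarith)]
    have h1 := negMulLog_add_le (r := a - b) hb (by linarith)
    rw [add_sub_cancel] at h1
    linarith

theorem negMulLog_le_tangent {r c : ℝ} (hr : 0 ≤ r) (hc : 0 < c) :
    Real.negMulLog r ≤ r * (-Real.log c - 1) + c := by
  rcases hr.eq_or_lt with rfl | hr
  · simpa using hc.le
  have h : Real.log (c / r) ≤ c / r - 1 := Real.log_le_sub_one_of_pos (by positivity)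
  rw [Real.log_div hc.ne' hr.ne'] at h
  have h3 : r * (Real.log c - Real.log r) ≤ c - r := by
    calc _ ≤ r * (c / r - 1) := by gcongr
      _ = c - r := by field_simp
  simp only [Real.negMulLog]
  linarith

theorem finEntropy_sub_le {A : Type*} [Fintype A] {p q : A → ℝ} (hp : p ∈ stdSimplex ℝ A)
    (hq : q ∈ stdSimplex ℝ A) {θ N : ℝ} (hθ : 0 < θ) (hpq : ∑ a, |p a - q a| ≤ θ) (hN0 : 0 < N)
    (hN : (Fintype.card A : ℝ) ≤ N) (hlog : 1 ≤ Real.log (N / θ)) :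
    finEntropy p - finEntropy q ≤ 2 * (θ * Real.log (N / θ)) := by
  have hc : 0 < θ / N := by positivity
  have hlc : -Real.log (θ / N) = Real.log (N / θ) := by rw [← Real.log_inv, inv_div]
  have hsum : finEntropy p - finEntropy q ≤
      ∑ a, (|p a - q a| * Real.log (N / θ) + θ / N) := by
    rw [finEntropy, finEntropy, ← sum_sub_distrib]
    refine sum_le_sum fun a _ => ?_
    have h1 := negMulLog_sub_le (hp.1 a) (hq.1 a)
      (le_one_of_mem_stdSimplex hq a)
    have h2 := negMulLog_le_tangent (abs_nonneg (p a - q a)) hc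
    rw [hlc] at h2
    linarith
  rw [sum_add_distrib, ← sum_mul, sum_const, card_univ, nsmul_eq_mul] at hsum
  have h1 : (∑ a, |p a - q a|) * Real.log (N / θ) ≤ θ * Real.log (N / θ) := by gcongr
  have h2 : (Fintype.card A : ℝ) * (θ / N) ≤ θ := by
    calc _ ≤ N * (θ / N) := by gcongr
      _ = θ := by field_simp
  nlinarith

theorem finEntropy_nonneg {A : Type*} [Fintype A] {p : A → ℝ} (hp : p ∈ stdSimplex ℝ A) :
    0 ≤ finEntropy p :=
  sum_nonneg fun a _ => Real.negMulLog_nonneg (hp.1 a) (le_one_of_mem_stdSimplex hp a)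

theorem finEntropy_le_card {A : Type*} [Fintype A] {p : A → ℝ} (hp : p ∈ stdSimplex ℝ A) :
    finEntropy p ≤ Fintype.card A := by
  calc finEntropy p ≤ ∑ _a : A, (1 : ℝ) := by
        refine sum_le_sum fun a _ => ?_
        have h := negMulLog_le_tangent (hp.1 a) one_pos
        rw [Real.log_one] at h
        linarith [hp.1 a]
    _ = Fintype.card A := by simp

theorem sndMarginal_mem_stdSimplex {A B : Type*} [Fintype A] [Fintype B] {p : A × B → ℝ}
    (hp : p ∈ stdSimplex ℝ (A × B)) : sndMarginal p ∈ stdSimplex ℝ B := by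
  refine ⟨fun b => sum_nonneg fun a _ => hp.1 _, ?_⟩
  simp only [sndMarginal]
  rw [← Fintype.sum_prod_type_right, hp.2]

theorem sum_abs_sndMarginal_sub_le {A B : Type*} [Fintype A] [Fintype B] (p q : A × B → ℝ) :
    ∑ b, |sndMarginal p b - sndMarginal q b| ≤ ∑ c, |p c - q c| := by
  rw [Fintype.sum_prod_type_right]
  refine sum_le_sum fun b _ => ?_
  rw [sndMarginal, sndMarginal, ← sum_sub_distrib]
  exact abs_sum_le_sum_abs _ _

section Channel

variable {𝒳 𝒲 Xh : Type*} [Fintype 𝒳] [Fintype 𝒲] [Fintype Xh]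

theorem jointMass_mem_stdSimplex {Q : 𝒳 × 𝒲 → ℝ} {V : 𝒳 × 𝒲 → Xh → ℝ}
    (hQ : Q ∈ stdSimplex ℝ (𝒳 × 𝒲)) (hV : ∀ p, V p ∈ stdSimplex ℝ Xh) :
    jointMass Q V ∈ stdSimplex ℝ (𝒳 × 𝒲 × Xh) := by
  refine ⟨fun a => mul_nonneg (hQ.1 _) ((hV _).1 _), ?_⟩
  have h := hQ.2
  simp only [Fintype.sum_prod_type, jointMass, ← mul_sum, (hV _).2, mul_one] at h ⊢
  exact h

theorem condMutualInfo_term {q v s m : ℝ} (hq : 0 ≤ q) (hv : 0 ≤ v) (hqs : q ≤ s)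
    (hm : q * v ≤ m) :
    q * v * Real.log (v / (m / s)) =
      q * v * Real.log (q * v) + q * v * Real.log s - q * v * Real.log q
        - q * v * Real.log m := by
  rcases hq.eq_or_lt with rfl | hq
  · simp
  rcases hv.eq_or_lt with rfl | hv
  · simp
  have hs : 0 < s := hq.trans_le hqs
  have hm : 0 < m := (mul_pos hq hv).trans_le hm
  rw [Real.log_div hv.ne' (by positivity), Real.log_div hm.ne' hs.ne',
    Real.log_mul hq.ne' hv.ne']
  ring

theorem condMutualInfo_mul_log_two {Q : 𝒳 × 𝒲 → ℝ} {V : 𝒳 × 𝒲 → Xh → ℝ}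
    (hQ : Q ∈ stdSimplex ℝ (𝒳 × 𝒲)) (hV : ∀ p, V p ∈ stdSimplex ℝ Xh) :
    condMutualInfo Q V * Real.log 2 =
      finEntropy Q + finEntropy (sndMarginal (jointMass Q V)) - finEntropy (sndMarginal Q)
        - finEntropy (jointMass Q V) := by
  have hterm : ∀ x w xh, Q (x, w) * V (x, w) xh * Real.logb 2 (V (x, w) xh /
      (∑ x', (Q (x', w) / ∑ x'', Q (x'', w)) * V (x', w) xh)) * Real.log 2 =
      Q (x, w) * V (x, w) xh * Real.log (Q (x, w) * V (x, w) xh)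
      + Q (x, w) * V (x, w) xh * Real.log (sndMarginal Q w)
      - Q (x, w) * V (x, w) xh * Real.log (Q (x, w))
      - Q (x, w) * V (x, w) xh * Real.log (sndMarginal (jointMass Q V) (w, xh)) := by
    intro x w xh
    have hsum : ∑ x', (Q (x', w) / ∑ x'', Q (x'', w)) * V (x', w) xh =
        sndMarginal (jointMass Q V) (w, xh) / sndMarginal Q w := by
      simp only [sndMarginal, jointMass, sum_div, div_mul_eq_mul_div]
    rw [hsum, ← condMutualInfo_term (hQ.1 _) ((hV _).1 _), Real.logb, mul_assoc,
      div_mul_cancel₀ _ (Real.log_pos one_lt_two).ne']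
    · exact single_le_sum (f := fun x => Q (x, w)) (fun i _ => hQ.1 _) (mem_univ x)
    · exact single_le_sum (f := fun x => jointMass Q V (x, w, xh))
        (fun i _ => (jointMass_mem_stdSimplex hQ hV).1 _) (mem_univ x)
  have h1 : finEntropy Q = -∑ x, ∑ w, ∑ xh, Q (x, w) * V (x, w) xh * Real.log (Q (x, w)) := by
    simp only [finEntropy, Fintype.sum_prod_type, Real.negMulLog, ← sum_mul, ← mul_sum, (hV _).2,
      mul_one, neg_mul, sum_neg_distrib]
  have h2 : finEntropy (sndMarginal (jointMass Q V)) = -∑ x, ∑ w, ∑ xh,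
      Q (x, w) * V (x, w) xh * Real.log (sndMarginal (jointMass Q V) (w, xh)) := by
    rw [sum_comm]
    simp only [finEntropy, Fintype.sum_prod_type, Real.negMulLog, neg_mul, sum_neg_distrib]
    congr 1
    refine sum_congr rfl fun w _ => ?_
    rw [sum_comm]
    refine sum_congr rfl fun xh _ => ?_
    rw [← sum_mul]
    rfl
  have h3 : finEntropy (sndMarginal Q) =
      -∑ x, ∑ w, ∑ xh, Q (x, w) * V (x, w) xh * Real.log (sndMarginal Q w) := by
    rw [sum_comm]
    simp only [finEntropy, Real.negMulLog, neg_mul, sum_neg_distrib, ← sum_mul, ← mul_sum,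
      (hV _).2, mul_one]
    rfl
  have h4 : finEntropy (jointMass Q V) =
      -∑ x, ∑ w, ∑ xh, Q (x, w) * V (x, w) xh * Real.log (Q (x, w) * V (x, w) xh) := by
    simp only [finEntropy, Fintype.sum_prod_type, Real.negMulLog, neg_mul, sum_neg_distrib]
    rfl
  simp only [condMutualInfo, sum_mul, hterm, sum_add_distrib, sum_sub_distrib]
  rw [h1, h2, h3, h4]
  ring

theorem condMutualInfo_lower_bound {Q : 𝒳 × 𝒲 → ℝ} {V : 𝒳 × 𝒲 → Xh → ℝ}
    (hQ : Q ∈ stdSimplex ℝ (𝒳 × 𝒲)) (hV : ∀ p, V p ∈ stdSimplex ℝ Xh) :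
    -(Fintype.card 𝒲 + Fintype.card (𝒳 × 𝒲 × Xh)) / Real.log 2 ≤ condMutualInfo Q V := by
  have hJ := jointMass_mem_stdSimplex hQ hV
  rw [div_le_iff₀ (Real.log_pos one_lt_two), condMutualInfo_mul_log_two hQ hV]
  linarith [finEntropy_nonneg hQ, finEntropy_nonneg (sndMarginal_mem_stdSimplex hJ),
    finEntropy_le_card (sndMarginal_mem_stdSimplex hQ), finEntropy_le_card hJ]

theorem condMutualInfo_sub_le [Nonempty 𝒳] [Nonempty 𝒲] [Nonempty Xh] {P Q : 𝒳 × 𝒲 → ℝ}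
    {U V : 𝒳 × 𝒲 → Xh → ℝ} (hP : P ∈ stdSimplex ℝ (𝒳 × 𝒲)) (hQ : Q ∈ stdSimplex ℝ (𝒳 × 𝒲))
    (hU : ∀ p, U p ∈ stdSimplex ℝ Xh) (hV : ∀ p, V p ∈ stdSimplex ℝ Xh) {θ N : ℝ} (hθ : 0 < θ)
    (hPQ : ∑ p, |P p - Q p| ≤ θ) (hUV : ∑ a, |jointMass P U a - jointMass Q V a| ≤ θ)
    (hN : (Fintype.card 𝒳 : ℝ) * Fintype.card 𝒲 * Fintype.card Xh = N)
    (hlog : 1 ≤ Real.log (N / θ)) :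
    condMutualInfo P U - condMutualInfo Q V ≤ 8 * θ * Real.logb 2 (N / θ) := by
  have hx : (1 : ℝ) ≤ Fintype.card 𝒳 := by exact_mod_cast Fintype.card_pos
  have hw : (1 : ℝ) ≤ Fintype.card 𝒲 := by exact_mod_cast Fintype.card_pos
  have hxh : (1 : ℝ) ≤ Fintype.card Xh := by exact_mod_cast Fintype.card_pos
  have hN0 : 0 < N := by rw [← hN]; positivity
  have hJP := jointMass_mem_stdSimplex hP hU
  have hJQ := jointMass_mem_stdSimplex hQ hV
  have hcJ : (Fintype.card (𝒳 × 𝒲 × Xh) : ℝ) ≤ N := by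
    simp only [Fintype.card_prod, Nat.cast_mul, ← hN, mul_assoc, le_refl]
  have hcQ : (Fintype.card (𝒳 × 𝒲) : ℝ) ≤ N := by
    simp only [Fintype.card_prod, Nat.cast_mul, ← hN]
    exact le_mul_of_one_le_right (by positivity) hxh
  have hcM : (Fintype.card (𝒲 × Xh) : ℝ) ≤ N := by
    simp only [Fintype.card_prod, Nat.cast_mul, ← hN, mul_assoc]
    exact le_mul_of_one_le_left (by positivity) hx
  have hcW : (Fintype.card 𝒲 : ℝ) ≤ N := by
    refine le_trans ?_ hcM
    simp only [Fintype.card_prod, Nat.cast_mul]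
    exact le_mul_of_one_le_right (by positivity) hxh
  have h1 := finEntropy_sub_le hP hQ hθ hPQ hN0 hcQ hlog
  have h2 := finEntropy_sub_le (sndMarginal_mem_stdSimplex hJP) (sndMarginal_mem_stdSimplex hJQ) hθ
    ((sum_abs_sndMarginal_sub_le _ _).trans hUV) hN0 hcM hlog
  have h3 := finEntropy_sub_le (sndMarginal_mem_stdSimplex hQ) (sndMarginal_mem_stdSimplex hP) hθ
    ((sum_abs_sndMarginal_sub_le _ _).trans (by simpa only [abs_sub_comm] using hPQ)) hN0 hcW hlog
  have h4 := finEntropy_sub_le hJQ hJP hθ (by simpa only [abs_sub_comm] using hUV) hN0 hcJ hlog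
  have hlog2 := Real.log_pos one_lt_two
  refine le_of_mul_le_mul_right ?_ hlog2
  rw [sub_mul, condMutualInfo_mul_log_two hP hU, condMutualInfo_mul_log_two hQ hV, mul_assoc,
    Real.logb, div_mul_cancel₀ _ hlog2.ne']
  linarith

/-- A test channel for `Q` can be transported to `P` without increasing the distortion, moving
the joint law by no more than the sources differ: the excess mass of `P` over `Q` is sent to
zero-distortion reconstructions. -/
theorem exists_channel_transport {P Q : 𝒳 × 𝒲 → ℝ} {V : 𝒳 × 𝒲 → Xh → ℝ}
    (hP : ∀ p, 0 ≤ P p) (hQ : ∀ p, 0 ≤ Q p) (hV : ∀ p, V p ∈ stdSimplex ℝ Xh)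
    {d : 𝒳 × Xh → ℝ} (hd : ∀ q, 0 ≤ d q) (hzero : ∀ x, ∃ xh, d (x, xh) = 0) :
    ∃ U : 𝒳 × 𝒲 → Xh → ℝ, (∀ p, U p ∈ stdSimplex ℝ Xh) ∧
      (∑ x, ∑ w, ∑ xh, P (x, w) * U (x, w) xh * d (x, xh)) ≤
        ∑ x, ∑ w, ∑ xh, Q (x, w) * V (x, w) xh * d (x, xh) ∧
      ∑ a, |jointMass P U a - jointMass Q V a| ≤ ∑ p, |P p - Q p| := by
  classical
  choose z hz using hzero
  let δ : 𝒳 → Xh → ℝ := fun x => Pi.single (z x) 1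
  have hδ : ∀ x, δ x ∈ stdSimplex ℝ Xh := fun x => single_mem_stdSimplex ℝ (z x)
  have hδd : ∀ x xh, δ x xh * d (x, xh) = 0 := by
    intro x xh
    rcases eq_or_ne xh (z x) with rfl | h
    · simp [hz]
    · simp [δ, h]
  have hU : ∀ p : 𝒳 × 𝒲, ∃ u ∈ stdSimplex ℝ Xh,
      ∀ xh, P p * u xh = min (P p) (Q p) * V p xh + (P p - min (P p) (Q p)) * δ p.1 xh := by
    intro p
    rcases (hP p).eq_or_lt with h | h
    · refine ⟨V p, hV p, fun xh => ?_⟩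
      rw [← h, min_eq_left (hQ p)]
      ring
    · have hmin : min (P p) (Q p) ≤ P p := min_le_left _ _
      have hmin0 : 0 ≤ min (P p) (Q p) := le_min (hP p) (hQ p)
      refine ⟨(min (P p) (Q p) / P p) • V p + ((P p - min (P p) (Q p)) / P p) • δ p.1,
        convex_stdSimplex ℝ Xh (hV p) (hδ _) (by positivity)
          (div_nonneg (by linarith) h.le) (by field_simp; ring), fun xh => ?_⟩
      simp only [Pi.add_apply, Pi.smul_apply, smul_eq_mul]
      field_simp
  choose U hUmem hUeq using hU
  refine ⟨U, hUmem, ?_, ?_⟩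
  · refine sum_le_sum fun x _ => sum_le_sum fun w _ => sum_le_sum fun xh _ => ?_
    rw [hUeq, add_mul, mul_assoc (P _ - _), hδd, mul_zero, add_zero]
    have := (hV (x, w)).1 xh
    have := hd (x, xh)
    gcongr
    exact min_le_right _ _
  · have hpt : ∀ p xh, |P p * U p xh - Q p * V p xh| ≤
        (P p - min (P p) (Q p)) * δ p.1 xh + (Q p - min (P p) (Q p)) * V p xh := by
      intro p xh
      have h1 : 0 ≤ (P p - min (P p) (Q p)) * δ p.1 xh :=
        mul_nonneg (sub_nonneg.2 (min_le_left _ _)) ((hδ _).1 _)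
      have h2 : 0 ≤ (Q p - min (P p) (Q p)) * V p xh :=
        mul_nonneg (sub_nonneg.2 (min_le_right _ _)) ((hV _).1 _)
      rw [hUeq, abs_le]
      constructor <;> linarith
    have hsum : ∀ p, ∑ xh, |P p * U p xh - Q p * V p xh| ≤ |P p - Q p| := by
      intro p
      refine (sum_le_sum fun xh _ => hpt p xh).trans ?_
      rw [sum_add_distrib, ← mul_sum, ← mul_sum, (hδ _).2, (hV _).2]
      rcases le_total (P p) (Q p) with h | h
      · rw [min_eq_left h, abs_of_nonpos (by linarith)]
        linarith
      · rw [min_eq_right h, abs_of_nonneg (by linarith)]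
        linarith
    simp only [Fintype.sum_prod_type, jointMass]
    exact sum_le_sum fun x _ => sum_le_sum fun w _ => hsum (x, w)

theorem condRD_sub_le [Nonempty 𝒳] [Nonempty 𝒲] [Nonempty Xh] {P Q : 𝒳 × 𝒲 → ℝ}
    (hP : P ∈ stdSimplex ℝ (𝒳 × 𝒲)) (hQ : Q ∈ stdSimplex ℝ (𝒳 × 𝒲)) {d : 𝒳 × Xh → ℝ}
    (hd : ∀ q, 0 ≤ d q) (hzero : ∀ x, ∃ xh, d (x, xh) = 0) {D : ℝ} (hD : 0 ≤ D) {θ N : ℝ}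
    (hθ : 0 < θ) (hPQ : ∑ p, |P p - Q p| ≤ θ)
    (hN : (Fintype.card 𝒳 : ℝ) * Fintype.card 𝒲 * Fintype.card Xh = N)
    (hlog : 1 ≤ Real.log (N / θ)) :
    condRD P d D - condRD Q d D ≤ 8 * θ * Real.logb 2 (N / θ) := by
  classical
  rw [sub_le_comm]
  refine le_csInf ?_ ?_
  · choose z hz using hzero
    refine ⟨_, fun p => Pi.single (z p.1) 1, fun p => (single_mem_stdSimplex ℝ (z p.1)).1,
      fun p => (single_mem_stdSimplex ℝ (z p.1)).2, ?_, rfl⟩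
    simpa [Pi.single_apply, hz] using hD
  · rintro r ⟨V, hV0, hV1, hVD, rfl⟩
    have hV : ∀ p, V p ∈ stdSimplex ℝ Xh := fun p => ⟨hV0 p, hV1 p⟩
    obtain ⟨U, hU, hUd, hUV⟩ := exists_channel_transport hP.1 hQ.1 hV hd hzero
    have hI := condMutualInfo_sub_le hP hQ hU hV hθ hPQ (hUV.trans hPQ) hN hlog
    have hR : condRD P d D ≤ condMutualInfo P U := by
      refine csInf_le ⟨-(Fintype.card 𝒲 + Fintype.card (𝒳 × 𝒲 × Xh)) / Real.log 2, ?_⟩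
        ⟨U, fun p => (hU p).1, fun p => (hU p).2, hUd.trans hVD, rfl⟩
      rintro r ⟨T, hT0, hT1, -, rfl⟩
      exact condMutualInfo_lower_bound hP fun p => ⟨hT0 p, hT1 p⟩
    linarith

end Channel

/-- Uniform continuity of the conditional rate-distortion function in the source
distribution (Lemma continuityp): `|R_{X|W}(P,D) − R_{X|W}(Q,D)| ≤
10·(d̄/d_min)·‖P−Q‖₁·log₂(|𝒳||𝒲||X̂|/‖P−Q‖₁)` when `‖P−Q‖₁ ≤ 1/2`. -/
theorem condRD_continuity_in_source
    {𝒳 𝒲 Xh : Type*} [Fintype 𝒳] [Fintype 𝒲] [Fintype Xh] [Nonempty 𝒳] [Nonempty 𝒲] [Nonempty Xh]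
    (P Q : 𝒳 × 𝒲 → ℝ)
    (hP0 : ∀ p, 0 ≤ P p) (hP1 : ∑ p, P p = 1)
    (hQ0 : ∀ p, 0 ≤ Q p) (hQ1 : ∑ p, Q p = 1)
    (d : 𝒳 × Xh → ℝ) (dbar : ℝ)
    (hd0 : ∀ q, 0 ≤ d q) (hdbar : ∀ q, d q ≤ dbar)
    (hzero : ∀ x, ∃ xh, d (x, xh) = 0)
    (dmin : ℝ) (hdminpos : 0 < dmin)
    (hdmin : IsLeast { r : ℝ | 0 < r ∧ ∃ q, d q = r } dmin)
    (D : ℝ) (hD : 0 ≤ D)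
    (hsmall : ∑ p, |P p - Q p| ≤ 1 / 2) :
    |condRD P d D - condRD Q d D| ≤
      10 * (dbar / dmin) * (∑ p, |P p - Q p|) *
        Real.logb 2 ((Fintype.card 𝒳 : ℝ) * (Fintype.card 𝒲 : ℝ) * (Fintype.card Xh : ℝ) /
          (∑ p, |P p - Q p|)) := by
  obtain ⟨-, ⟨x₀, y₀⟩, hq₀⟩ := hdmin.1
  obtain ⟨y₁, hy₁⟩ := hzero x₀
  have hratio : 1 ≤ dbar / dmin := by
    rw [one_le_div hdminpos, ← hq₀]
    exact hdbar _
  have hθ0 : 0 ≤ ∑ p, |P p - Q p| := sum_nonneg fun p _ => abs_nonneg _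
  rcases hθ0.eq_or_lt with hθ | hθ
  · have hPQ : P = Q := by
      funext p
      have h := (sum_eq_zero_iff_of_nonneg fun p _ => abs_nonneg (P p - Q p)).1 hθ.symm p
        (mem_univ p)
      exact sub_eq_zero.1 (abs_eq_zero.1 h)
    simp [hPQ]
  have hsymm : ∑ p, |Q p - P p| = ∑ p, |P p - Q p| := by simp only [abs_sub_comm]
  set θ := ∑ p, |P p - Q p|
  set N : ℝ := (Fintype.card 𝒳 : ℝ) * (Fintype.card 𝒲 : ℝ) * (Fintype.card Xh : ℝ) with hN
  have hN2 : 2 ≤ N := by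
    have hx : (1 : ℝ) ≤ Fintype.card 𝒳 := by exact_mod_cast Fintype.card_pos
    have hw : (1 : ℝ) ≤ Fintype.card 𝒲 := by exact_mod_cast Fintype.card_pos
    have hne : y₀ ≠ y₁ := by
      rintro rfl
      linarith
    have hxh : (2 : ℝ) ≤ Fintype.card Xh := by
      exact_mod_cast Fintype.one_lt_card_iff.2 ⟨y₀, y₁, hne⟩
    rw [hN]
    exact hxh.trans (le_mul_of_one_le_left (by positivity) (one_le_mul_of_one_le_of_one_le hx hw))
  have hlog : 1 ≤ Real.log (N / θ) := by
    rw [Real.le_log_iff_exp_le (by positivity), le_div_iff₀ hθ]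
    nlinarith [Real.exp_one_lt_d9, Real.exp_pos 1]
  have hlogb : 0 ≤ θ * Real.logb 2 (N / θ) :=
    mul_nonneg hθ0 (div_nonneg (by linarith) (Real.log_pos one_lt_two).le)
  have h1 := condRD_sub_le ⟨hP0, hP1⟩ ⟨hQ0, hQ1⟩ hd0 hzero hD hθ le_rfl hN.symm hlog
  have h2 := condRD_sub_le ⟨hQ0, hQ1⟩ ⟨hP0, hP1⟩ hd0 hzero hD hθ hsymm.le hN.symm hlog
  have hbound : 8 * θ * Real.logb 2 (N / θ) ≤ 10 * (dbar / dmin) * θ * Real.logb 2 (N / θ) := by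
    rw [mul_assoc, mul_assoc (10 * _)]
    exact mul_le_mul_of_nonneg_right (by linarith) hlogb
  rw [abs_le]
  constructor <;> linarith
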